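/- arXiv:1407.0675 — 2 statements merged into one kernel-verified Lean document; each statement's English description precedes it below -/
import Mathlib

section
/- Let θ ∈ [1/2, 1] and set K₁(θ) := (1/2)·(2/θ)^θ·(2θ−1)^{θ−1/2} (with the convention 0⁰ = 1, so K₁(1/2) = 1). Then for every u ∈ l²(ℤ), u(0)² ≤ K₁(θ)·‖u‖^{2θ}·‖Du‖^{2(1−θ)}. Moreover K₁(θ) is sharp: it is the least constant C such that u(0)² ≤ C·‖u‖^{2θ}·‖Du‖^{2(1−θ)} holds for all u ∈ l²(ℤ). -/
open Real

/-- Expansion of `0 ≤ ∑ (x (n+1) - q x n)²` over the half-line. -/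
lemma half_line_quadratic_nonneg (x : ℕ → ℝ) (q S T : ℝ)
    (hS : HasSum (fun n => x n ^ 2) S) (hT : HasSum (fun n => x n * x (n + 1)) T) :
    0 ≤ (1 + q ^ 2) * S - x 0 ^ 2 - 2 * q * T := by
  have h1 : HasSum (fun n => x (n + 1) ^ 2) (S - x 0 ^ 2) := by
    have := (hasSum_nat_add_iff' (f := fun n => x n ^ 2) 1).2 hS
    simpa using this
  have h := (h1.add (hS.mul_left (q ^ 2))).sub (hT.mul_left (2 * q))
  have h0 := h.nonneg fun n => by nlinarith [sq_nonneg (x (n + 1) - q * x n)]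
  linarith

lemma summable_mul_of_sq {ι : Type*} {x y : ι → ℝ} (hx : Summable fun n => x n ^ 2)
    (hy : Summable fun n => y n ^ 2) : Summable fun n => x n * y n := by
  refine Summable.of_norm_bounded (hx.add hy) fun n => ?_
  rw [Real.norm_eq_abs, abs_le]
  constructor <;> nlinarith [sq_nonneg (x n + y n), sq_nonneg (x n - y n)]

/-- The sharp discrete bound `u(0)⁴ ≤ ‖Du‖² (4‖u‖² - ‖Du‖²) / 4`. -/
lemma four_mul_pow_four_le (u : ℤ → ℝ) (hu : Summable fun n => u n ^ 2) :
    4 * (u 0 ^ 2) ^ 2 ≤ (∑' n : ℤ, (u (n + 1) - u n) ^ 2) *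
      (4 * (∑' n : ℤ, u n ^ 2) - ∑' n : ℤ, (u (n + 1) - u n) ^ 2) := by
  have hu1 : Summable fun n : ℤ => u (n + 1) ^ 2 :=
    (Equiv.addRight (1 : ℤ)).summable_iff.2 hu
  have hu1_sum : ∑' n : ℤ, u (n + 1) ^ 2 = ∑' n : ℤ, u n ^ 2 :=
    (Equiv.addRight (1 : ℤ)).tsum_eq (fun n => u n ^ 2)
  have hm := summable_mul_of_sq hu hu1
  have hp : Summable fun n : ℕ => u n ^ 2 := hu.comp_injective Nat.cast_injective
  have hn : Summable fun n : ℕ => u (-n) ^ 2 :=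
    hu.comp_injective (neg_injective.comp Nat.cast_injective)
  have hpm : Summable fun n : ℕ => u n * u ((n + 1 : ℕ) : ℤ) :=
    summable_mul_of_sq hp ((summable_nat_add_iff (f := fun n : ℕ => u n ^ 2) 1).2 hp)
  have hnm : Summable fun n : ℕ => u (-n) * u (-((n + 1 : ℕ) : ℤ)) :=
    summable_mul_of_sq hn ((summable_nat_add_iff (f := fun n : ℕ => u (-n) ^ 2) 1).2 hn)
  have hA := (HasSum.of_nat_of_neg (f := fun n : ℤ => u n ^ 2) hp.hasSum hn.hasSum).tsum_eq
  have hC : ∑' n : ℤ, u n * u (n + 1) = (∑' n : ℕ, u n * u ((n + 1 : ℕ) : ℤ)) +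
      ∑' n : ℕ, u (-n) * u (-((n + 1 : ℕ) : ℤ)) := by
    refine (HasSum.of_nat_of_neg_add_one (f := fun n : ℤ => u n * u (n + 1)) ?_ ?_).tsum_eq
    · simpa using hpm.hasSum
    · convert hnm.hasSum using 2 with n
      rw [mul_comm]
      push_cast
      congr 2
      ring
  have hB : ∑' n : ℤ, (u (n + 1) - u n) ^ 2 =
      2 * (∑' n : ℤ, u n ^ 2) - 2 * ∑' n : ℤ, u n * u (n + 1) := by
    have := ((hu1.hasSum.add hu.hasSum).sub (hm.hasSum.mul_left 2)).tsum_eq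
    rw [hu1_sum, ← two_mul] at this
    rw [← this]
    exact tsum_congr fun n => by ring
  set A := ∑' n : ℤ, u n ^ 2
  set C := ∑' n : ℤ, u n * u (n + 1)
  have hq : ∀ q : ℝ, 0 ≤ (A + u 0 ^ 2) * (q * q) + (-2 * C) * q + (A - u 0 ^ 2) := fun q => by
    have h1 := half_line_quadratic_nonneg (fun n : ℕ => u n) q _ _ hp.hasSum hpm.hasSum
    have h2 := half_line_quadratic_nonneg (fun n : ℕ => u (-n)) q _ _ hn.hasSum hnm.hasSum
    simp only [Nat.cast_zero, neg_zero] at h1 h2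
    rw [hA, hC]
    linarith
  have hd := discrim_le_zero hq
  rw [discrim] at hd
  rw [hB]
  linarith

/-- Weighted AM-GM in the form needed to interpolate. -/
lemma mul_rpow_le_of_mem_Icc {θ A B : ℝ} (hθ : θ ∈ Set.Icc (1 / 2 : ℝ) 1) (hB : 0 ≤ B)
    (hAB : 0 ≤ 4 * A - B) :
    (4 * A - B) * (B / (2 * θ - 1)) ^ (2 * θ - 1) ≤ (2 / θ * A) ^ (2 * θ) := by
  obtain ⟨h1, -⟩ := hθ
  have hθ0 : 0 < θ := by linarith
  have ha : 0 ≤ 2 * θ - 1 := by linarith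
  have hy : 0 ≤ B / (2 * θ - 1) := div_nonneg hB ha
  have key := Real.geom_mean_le_arith_mean2_weighted (w₁ := 1 / (2 * θ))
    (w₂ := (2 * θ - 1) / (2 * θ)) (by positivity) (by positivity) hAB hy (by field_simp; ring)
  have hyB : (2 * θ - 1) * (B / (2 * θ - 1)) ≤ B := by
    rcases ha.eq_or_lt with h | h
    · simpa [← h] using hB
    · rw [mul_div_cancel₀ _ h.ne']
  have hle : 1 / (2 * θ) * (4 * A - B) + (2 * θ - 1) / (2 * θ) * (B / (2 * θ - 1)) ≤
      2 / θ * A := by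
    calc _ = 1 / (2 * θ) * (4 * A - B + (2 * θ - 1) * (B / (2 * θ - 1))) := by ring
      _ ≤ 1 / (2 * θ) * (4 * A) := by gcongr; linarith
      _ = 2 / θ * A := by field_simp; ring
  have h := Real.rpow_le_rpow (by positivity) (key.trans hle) (by positivity : 0 ≤ 2 * θ)
  rwa [Real.mul_rpow (by positivity) (by positivity), ← Real.rpow_mul hAB, ← Real.rpow_mul hy,
    div_mul_cancel₀ _ (by positivity), div_mul_cancel₀ _ (by positivity), Real.rpow_one] at h

lemma le_interpolation_of_sq_le {θ A B X : ℝ} (hθ : θ ∈ Set.Icc (1 / 2 : ℝ) 1) (hA : 0 ≤ A)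
    (hB : 0 ≤ B) (hX : 4 * X ^ 2 ≤ B * (4 * A - B)) :
    X ≤ ((1 / 2) * (2 / θ) ^ θ * (2 * θ - 1) ^ (θ - 1 / 2)) * A ^ θ * B ^ (1 - θ) := by
  have hθ0 : 0 < θ := by linarith [hθ.1]
  have ha : 0 ≤ 2 * θ - 1 := by linarith [hθ.1]
  rcases hB.eq_or_lt with rfl | hB'
  · have : X = 0 := by
      have : X ^ 2 ≤ 0 := by linarith
      exact pow_eq_zero_iff two_ne_zero |>.1 (le_antisymm this (sq_nonneg X))
    rw [this]
    positivity
  have hAB : 0 ≤ 4 * A - B := nonneg_of_mul_nonneg_right (by nlinarith [sq_nonneg X]) hB'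
  have key := mul_rpow_le_of_mem_Icc hθ hB hAB
  have hsq : ∀ {x : ℝ} (y : ℝ), 0 ≤ x → (x ^ y) ^ 2 = x ^ (2 * y) := fun y hx => by
    rw [← Real.rpow_mul_natCast hx, Nat.cast_ofNat, mul_comm]
  have hapos : 0 < (2 * θ - 1) ^ (2 * θ - 1) := by
    rcases ha.eq_or_lt with h | h
    · simp [← h]
    · positivity
  have hBB : B ^ (2 * θ - 1) * B ^ (2 * (1 - θ)) = B := by
    rw [← Real.rpow_add hB', show 2 * θ - 1 + 2 * (1 - θ) = 1 by ring, Real.rpow_one]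
  refine le_of_sq_le_sq ?_ (by positivity)
  rw [Real.div_rpow hB ha, ← mul_div_assoc, div_le_iff₀ hapos,
    Real.mul_rpow (by positivity) hA] at key
  have h2 := mul_le_mul_of_nonneg_right key (by positivity : 0 ≤ B ^ (2 * (1 - θ)))
  rw [mul_assoc, hBB] at h2
  simp only [mul_pow]
  rw [hsq _ (by positivity), hsq _ ha, hsq _ hA, hsq _ hB,
    show 2 * (θ - 1 / 2) = 2 * θ - 1 by ring]
  linarith

lemma hasSum_geometric_sq {q : ℝ} (h0 : 0 ≤ q) (h1 : q < 1) :
    HasSum (fun n : ℕ => (q ^ n) ^ 2) (1 - q ^ 2)⁻¹ := by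
  convert hasSum_geometric_of_lt_one (sq_nonneg q) (by nlinarith : q ^ 2 < 1) using 2 with n
  rw [← pow_mul, ← pow_mul, mul_comm]

lemma hasSum_sq_pow_natAbs {q : ℝ} (h0 : 0 ≤ q) (h1 : q < 1) :
    HasSum (fun n : ℤ => (q ^ n.natAbs) ^ 2) ((1 + q ^ 2) / (1 - q ^ 2)) := by
  have hg := hasSum_geometric_sq h0 h1
  have hne : 1 - q ^ 2 ≠ 0 := by nlinarith
  have h := HasSum.of_nat_of_neg (f := fun n : ℤ => (q ^ n.natAbs) ^ 2)
    (by simpa using hg) (by simpa using hg)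
  rwa [show (1 - q ^ 2)⁻¹ + (1 - q ^ 2)⁻¹ - (q ^ (0 : ℤ).natAbs) ^ 2 =
    (1 + q ^ 2) / (1 - q ^ 2) by simp; field_simp; ring] at h

lemma hasSum_sq_sub_pow_natAbs {q : ℝ} (h0 : 0 ≤ q) (h1 : q < 1) :
    HasSum (fun n : ℤ => (q ^ (n + 1).natAbs - q ^ n.natAbs) ^ 2) (2 * (1 - q) / (1 + q)) := by
  have hg := (hasSum_geometric_sq h0 h1).mul_left ((1 - q) ^ 2)
  have hne : 1 - q ^ 2 ≠ 0 := by nlinarith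
  have hplus : 1 + q ≠ 0 := by linarith
  rw [show 2 * (1 - q) / (1 + q) =
    (1 - q) ^ 2 * (1 - q ^ 2)⁻¹ + (1 - q) ^ 2 * (1 - q ^ 2)⁻¹ by field_simp; ring]
  refine HasSum.of_nat_of_neg_add_one ?_ ?_
  · refine hg.congr_fun fun n => ?_
    rw [show ((n : ℤ) + 1).natAbs = n + 1 by omega, Int.natAbs_natCast]
    ring
  · refine hg.congr_fun fun n => ?_
    rw [show (-((n : ℤ) + 1) + 1).natAbs = n by omega,
      show (-((n : ℤ) + 1)).natAbs = n + 1 by omega]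
    ring

/-- Testing an interpolation inequality on `n ↦ q ^ |n|` with `q = (1 - r) / (1 + r)`. -/
lemma one_le_of_interpolation {θ C r : ℝ} (hr0 : 0 < r) (hr1 : r ≤ 1)
    (h : ∀ u : ℤ → ℝ, Summable (fun n => u n ^ 2) →
      u 0 ^ 2 ≤ C * (∑' n : ℤ, u n ^ 2) ^ θ *
        (∑' n : ℤ, (u (n + 1) - u n) ^ 2) ^ (1 - θ)) :
    1 ≤ C * ((1 + r ^ 2) / (2 * r)) ^ θ * (2 * r) ^ (1 - θ) := by
  have h0 : 0 ≤ (1 - r) / (1 + r) := div_nonneg (by linarith) (by linarith)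
  have h1 : (1 - r) / (1 + r) < 1 := by rw [div_lt_one (by linarith)]; linarith
  have hA := hasSum_sq_pow_natAbs h0 h1
  have hB := hasSum_sq_sub_pow_natAbs h0 h1
  have := h (fun n => ((1 - r) / (1 + r)) ^ n.natAbs) hA.summable
  rw [hA.tsum_eq, hB.tsum_eq] at this
  have hr : 1 + r ≠ 0 := by linarith
  have e1 : (1 + ((1 - r) / (1 + r)) ^ 2) / (1 - ((1 - r) / (1 + r)) ^ 2) =
      (1 + r ^ 2) / (2 * r) := by
    have : 1 - ((1 - r) / (1 + r)) ^ 2 = 4 * r / (1 + r) ^ 2 := by field_simp; ring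
    rw [this]
    field_simp
    ring
  have e2 : 2 * (1 - (1 - r) / (1 + r)) / (1 + (1 - r) / (1 + r)) = 2 * r := by
    have : 1 + (1 - r) / (1 + r) = 2 / (1 + r) := by field_simp; ring
    rw [this]
    field_simp
    ring
  rw [e1, e2] at this
  simpa using this

theorem sharp_interpolation_1D (θ : ℝ) (hθ : θ ∈ Set.Icc (1 / 2 : ℝ) 1) :
    (∀ u : ℤ → ℝ, Summable (fun n => u n ^ 2) →
      u 0 ^ 2 ≤ ((1 / 2) * (2 / θ) ^ θ * (2 * θ - 1) ^ (θ - 1 / 2)) *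
        (∑' n : ℤ, u n ^ 2) ^ θ * (∑' n : ℤ, (u (n + 1) - u n) ^ 2) ^ (1 - θ)) ∧
    (∀ C : ℝ,
      (∀ u : ℤ → ℝ, Summable (fun n => u n ^ 2) →
        u 0 ^ 2 ≤ C * (∑' n : ℤ, u n ^ 2) ^ θ *
          (∑' n : ℤ, (u (n + 1) - u n) ^ 2) ^ (1 - θ)) →
      (1 / 2) * (2 / θ) ^ θ * (2 * θ - 1) ^ (θ - 1 / 2) ≤ C) := by
  refine ⟨fun u hu => le_interpolation_of_sq_le hθ (tsum_nonneg fun n => sq_nonneg _)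
    (tsum_nonneg fun n => sq_nonneg _) (four_mul_pow_four_le u hu), fun C hC => ?_⟩
  rcases hθ.1.eq_or_lt with rfl | hθ'
  · have hK : (1 / 2 : ℝ) * (2 / (1 / 2)) ^ (1 / 2 : ℝ) *
        (2 * (1 / 2) - 1) ^ ((1 / 2 : ℝ) - 1 / 2) = 1 := by
      rw [← Real.sqrt_eq_rpow, show (2 / (1 / 2) : ℝ) = 2 ^ 2 by norm_num,
        Real.sqrt_sq (by norm_num)]
      norm_num
    rw [hK]
    have hlim : Filter.Tendsto (fun r : ℝ => C * √(1 + r ^ 2)) (nhdsWithin 0 (Set.Ioi 0))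
        (nhds C) := by
      have : Continuous fun r : ℝ => C * √(1 + r ^ 2) := by fun_prop
      simpa using (this.tendsto 0).mono_left nhdsWithin_le_nhds
    refine ge_of_tendsto hlim ?_
    filter_upwards [Ioc_mem_nhdsGT (zero_lt_one' ℝ)] with r hr
    have hr0 := hr.1
    have := one_le_of_interpolation hr.1 hr.2 hC
    rwa [show (1 - 1 / 2 : ℝ) = 1 / 2 by norm_num, mul_assoc,
      ← Real.mul_rpow (by positivity) (by positivity), div_mul_cancel₀ _ (by positivity),
      ← Real.sqrt_eq_rpow] at this
  · have hθ0 : 0 < θ := by linarith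
    have ha : 0 < 2 * θ - 1 := by linarith
    have hr0 : 0 < √(2 * θ - 1) := Real.sqrt_pos.2 ha
    have h := one_le_of_interpolation hr0
      (Real.sqrt_le_one.2 (by linarith [hθ.2])) hC
    rw [Real.sq_sqrt ha.le] at h
    have e : ((1 + (2 * θ - 1)) / (2 * √(2 * θ - 1))) ^ θ *
        (2 * √(2 * θ - 1)) ^ (1 - θ) *
        ((1 / 2) * (2 / θ) ^ θ * (2 * θ - 1) ^ (θ - 1 / 2)) = 1 := by
      rw [show 1 + (2 * θ - 1) = 2 * θ by ring, mul_div_mul_left _ _ two_ne_zero]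
      have hs : (2 * θ - 1) ^ (θ - 1 / 2) = √(2 * θ - 1) ^ (2 * θ - 1) := by
        rw [Real.sqrt_eq_rpow, ← Real.rpow_mul ha.le]
        congr 1
        ring
      have hp : √(2 * θ - 1) ^ (2 * θ - 1) =
          √(2 * θ - 1) ^ θ * √(2 * θ - 1) ^ θ / √(2 * θ - 1) := by
        rw [Real.rpow_sub_one hr0.ne', ← Real.rpow_add hr0, ← two_mul]
      rw [hs, Real.div_rpow hθ0.le hr0.le, Real.div_rpow zero_le_two hθ0.le,
        Real.mul_rpow zero_le_two hr0.le, Real.rpow_sub two_pos, hp,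
        Real.rpow_sub hr0]
      simp only [Real.rpow_one]
      field_simp
    calc _ ≤ (C * ((1 + (2 * θ - 1)) / (2 * √(2 * θ - 1))) ^ θ *
          (2 * √(2 * θ - 1)) ^ (1 - θ)) *
          ((1 / 2) * (2 / θ) ^ θ * (2 * θ - 1) ^ (θ - 1 / 2)) :=
          le_mul_of_one_le_left (by positivity) h
      _ = C := by rw [mul_assoc C, mul_assoc C, e, mul_one]
end

section
/- Let θ ∈ (0,1) and set K₃(θ) := (1/(2π²))·(1/(θ^θ·(1−θ)^{1−θ}))·sup_{λ>0} [ λ^θ·∫₀^π K(1/(λ/4 + 1 + sin²(x/2))) / (λ/4 + 1 + sin²(x/2)) dx ], where K is the complete elliptic integral of the first kind. Then K₃(θ) is finite and for every u ∈ l²(ℤ³), u(0,0,0)² ≤ K₃(θ)·‖u‖^{2θ}·‖∇u‖^{2(1−θ)}. -/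
open Real

/-- The complete elliptic integral of the first kind. -/
noncomputable def ellipticK (k : ℝ) : ℝ :=
  ∫ t in (0 : ℝ)..1, 1 / Real.sqrt ((1 - t ^ 2) * (1 - k ^ 2 * t ^ 2))

theorem summable_mul_of_summable_sq {α : Type*} {v w : α → ℝ} (hv : Summable fun p => v p ^ 2)
    (hw : Summable fun p => w p ^ 2) : Summable fun p => v p * w p := by
  refine Summable.of_norm_bounded (hv.add hw) fun p => ?_
  rw [Real.norm_eq_abs, abs_le]
  constructor <;> nlinarith [sq_nonneg (v p + w p), sq_nonneg (v p - w p), sq_nonneg (v p),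
    sq_nonneg (w p)]

section Lattice

variable {G ι : Type*} [AddCommGroup G] [Fintype ι] {v w : G → ℝ}

theorem summable_sq_shift (hv : Summable fun p => v p ^ 2) (a : G) :
    Summable fun p => v (p + a) ^ 2 :=
  (Equiv.addRight a).summable_iff (f := fun p => v p ^ 2) |>.2 hv

theorem summable_sq_difference (hv : Summable fun p => v p ^ 2) (a : G) :
    Summable fun p => (v (p + a) - v p) ^ 2 := by
  have h1 := summable_sq_shift hv a
  refine ((h1.add hv).sub ((summable_mul_of_summable_sq h1 hv).mul_left 2)).congr fun p => ?_
  ring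

/-- Summation by parts for a single difference. -/
theorem hasSum_difference_mul_difference (hv : Summable fun p => v p ^ 2)
    (hw : Summable fun p => w p ^ 2) (a : G) :
    HasSum (fun p => (v (p + a) - v p) * (w (p + a) - w p))
      (∑' p, v p * (2 * w p - w (p + a) - w (p - a))) := by
  have h0 := (summable_mul_of_summable_sq hv hw).hasSum
  have h1 : HasSum (fun p => v (p + a) * w (p + a)) (∑' p, v p * w p) :=
    (Equiv.addRight a).hasSum_iff.2 h0
  have h2 := (summable_mul_of_summable_sq hv (summable_sq_shift hw a)).hasSum
  have hw' : Summable fun p => w (p - a) ^ 2 := by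
    simpa only [sub_eq_add_neg] using summable_sq_shift hw (-a)
  have h3 := (summable_mul_of_summable_sq hv hw').hasSum
  have h4 : HasSum (fun p => v (p + a) * w p) (∑' p, v p * w (p - a)) := by
    have := (Equiv.addRight a).hasSum_iff.2 h3
    simpa [Function.comp_def] using this
  have h5 := ((h0.mul_left 2).sub h2).sub h3
  have h6 : ∑' p, v p * (2 * w p - w (p + a) - w (p - a)) =
      2 * (∑' p, v p * w p) - (∑' p, v p * w (p + a)) - ∑' p, v p * w (p - a) := by
    rw [← h5.tsum_eq]
    congr 1 with p
    ring
  rw [h6]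
  convert! ((h1.sub h4).sub h2).add h0 using 1
  · ext p; ring
  · ring

theorem hasSum_energy_of_isGreen [DecidableEq G] {lam : ℝ} {e : ι → G}
    (hv : Summable fun p => v p ^ 2) (hw : Summable fun p => w p ^ 2)
    (hgreen : ∀ p, lam * w p + ∑ i, (2 * w p - w (p + e i) - w (p - e i)) =
      if p = 0 then 1 else 0) :
    HasSum (fun p => lam * (v p * w p) +
      ∑ i, (v (p + e i) - v p) * (w (p + e i) - w p)) (v 0) := by
  have h0 := (summable_mul_of_summable_sq hv hw).hasSum
  have h1 := (h0.mul_left lam).add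
    (hasSum_sum fun i (_ : i ∈ Finset.univ) => hasSum_difference_mul_difference hv hw (e i))
  have h2 : ∀ i, Summable fun p => v p * (2 * w p - w (p + e i) - w (p - e i)) := by
    intro i
    have hw' : Summable fun p => w (p - e i) ^ 2 := by
      simpa only [sub_eq_add_neg] using summable_sq_shift hw (-e i)
    refine (((summable_mul_of_summable_sq hv hw).mul_left 2).sub
      (summable_mul_of_summable_sq hv (summable_sq_shift hw (e i)))).sub
      (summable_mul_of_summable_sq hv hw') |>.congr fun p => ?_
    ring
  have h3 := (h0.mul_left lam).add
    (hasSum_sum fun i (_ : i ∈ Finset.univ) => (h2 i).hasSum)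
  have h4 : HasSum (fun p => lam * (v p * w p) +
      ∑ i, v p * (2 * w p - w (p + e i) - w (p - e i))) (v 0) := by
    have : ∀ p, lam * (v p * w p) + ∑ i, v p * (2 * w p - w (p + e i) - w (p - e i)) =
        if p = 0 then v 0 else 0 := by
      intro p
      rw [← Finset.mul_sum, mul_left_comm, ← mul_add, hgreen]
      split_ifs with h
      · rw [h, mul_one]
      · rw [mul_zero]
    simp_rw [this]
    exact hasSum_ite_eq 0 (v 0)
  rw [h3.unique h4] at h1
  exact h1

/-- The value at the origin is controlled by the energy, with the Green's function as constant. -/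
theorem sq_apply_zero_le_green_mul_energy [DecidableEq G] {lam : ℝ} (hlam : 0 < lam) {e : ι → G}
    (hv : Summable fun p => v p ^ 2) (hw : Summable fun p => w p ^ 2)
    (hgreen : ∀ p, lam * w p + ∑ i, (2 * w p - w (p + e i) - w (p - e i)) =
      if p = 0 then 1 else 0) :
    v 0 ^ 2 ≤ w 0 * (lam * (∑' p, v p ^ 2) + ∑' p, ∑ i, (v (p + e i) - v p) ^ 2) := by
  have hvw := hasSum_energy_of_isGreen hv hw hgreen
  have hww := hasSum_energy_of_isGreen hw hw hgreen
  have hvv := (hv.hasSum.mul_left lam).add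
    (summable_sum fun i (_ : i ∈ Finset.univ) => summable_sq_difference hv (e i)).hasSum
  set E := lam * (∑' p, v p ^ 2) + ∑' p, ∑ i, (v (p + e i) - v p) ^ 2
  have key : ∀ t : ℝ, 0 ≤ w 0 * (t * t) + (-2 * v 0) * t + E := by
    intro t
    have h := (hvv.sub (hvw.mul_left (2 * t))).add (hww.mul_left (t ^ 2))
    have := h.nonneg (fun p => ?_)
    · linarith
    · have : lam * v p ^ 2 + ∑ i, (v (p + e i) - v p) ^ 2 -
          2 * t * (lam * (v p * w p) + ∑ i, (v (p + e i) - v p) * (w (p + e i) - w p)) +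
          t ^ 2 * (lam * (w p * w p) + ∑ i, (w (p + e i) - w p) * (w (p + e i) - w p)) =
          lam * (v p - t * w p) ^ 2 +
          ∑ i, ((v (p + e i) - v p) - t * (w (p + e i) - w p)) ^ 2 := by
        have : ∀ i, ((v (p + e i) - v p) - t * (w (p + e i) - w p)) ^ 2 =
            (v (p + e i) - v p) ^ 2 - 2 * t * ((v (p + e i) - v p) * (w (p + e i) - w p)) +
            t ^ 2 * ((w (p + e i) - w p) * (w (p + e i) - w p)) := fun i => by ring
        simp_rw [this, Finset.sum_add_distrib, Finset.sum_sub_distrib, ← Finset.mul_sum]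
        ring
      rw [this]
      positivity
  have := discrim_le_zero key
  rw [discrim] at this
  linarith

end Lattice

section Integrals

open MeasureTheory Set UnitAddTorus

theorem integral_period_eq_integral_arctan (g : ℝ → ℝ) :
    ∫ y in Ioo (-(1 / 2) : ℝ) (1 / 2), g y =
      ∫ x : ℝ, 1 / (π * (1 + x ^ 2)) * g (arctan x / π) := by
  have himg : (fun x : ℝ => arctan x / π) '' univ = Ioo (-(1 / 2) : ℝ) (1 / 2) := by
    ext y
    simp only [image_univ, mem_range, mem_Ioo]
    constructor
    · rintro ⟨x, rfl⟩
      have h1 := neg_pi_div_two_lt_arctan x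
      have h2 := arctan_lt_pi_div_two x
      rw [lt_div_iff₀ pi_pos, div_lt_iff₀ pi_pos]
      constructor <;> linarith
    · rintro ⟨h1, h2⟩
      refine ⟨tan (y * π), ?_⟩
      rw [arctan_tan (by nlinarith [pi_pos]) (by nlinarith [pi_pos])]
      field_simp
  rw [← himg, integral_image_eq_integral_abs_deriv_smul MeasurableSet.univ
    (f' := fun x => 1 / (1 + x ^ 2) / π)
    (fun x _ => ((hasDerivAt_arctan x).div_const π).hasDerivWithinAt)]
  · rw [setIntegral_univ]
    congr 1 with x
    rw [abs_of_nonneg (by positivity), smul_eq_mul, div_div, mul_comm π]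
  · intro x _ y _ h
    have h' : arctan x / π = arctan y / π := h
    exact arctan_injective ((div_left_inj' pi_pos.ne').1 h')

theorem cos_two_pi_mul_arctan_div_pi (x : ℝ) :
    cos (2 * π * (arctan x / π)) = (1 - x ^ 2) / (1 + x ^ 2) := by
  have : 2 * π * (arctan x / π) = 2 * arctan x := by field_simp
  rw [this, cos_two_mul, cos_sq_arctan]
  have : 0 < 1 + x ^ 2 := by positivity
  field_simp
  ring

theorem integral_inv_sub_two_mul_cos {A : ℝ} (hA : 2 < A) :
    ∫ y in Ioo (-(1 / 2) : ℝ) (1 / 2), 1 / (A - 2 * cos (2 * π * y)) =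
      1 / √((A - 2) * (A + 2)) := by
  rw [integral_period_eq_integral_arctan]
  have h1 : 0 < A - 2 := by linarith
  have h2 : 0 < A + 2 := by linarith
  set r := √((A + 2) / (A - 2)) with hr
  have hr0 : 0 < r := sqrt_pos.2 (by positivity)
  have hr2 : r ^ 2 = (A + 2) / (A - 2) := sq_sqrt (by positivity)
  have : ∀ x : ℝ, 1 / (π * (1 + x ^ 2)) * (1 / (A - 2 * cos (2 * π * (arctan x / π)))) =
      1 / (π * (A - 2)) * (1 + (r * x) ^ 2)⁻¹ := by
    intro x
    rw [cos_two_pi_mul_arctan_div_pi, mul_pow, hr2]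
    have h3 : 0 < 1 + x ^ 2 := by positivity
    have h4 : A - 2 * ((1 - x ^ 2) / (1 + x ^ 2)) = ((A - 2) + (A + 2) * x ^ 2) / (1 + x ^ 2) := by
      field_simp; ring
    rw [h4]
    have h5 : 0 < (A - 2) + (A + 2) * x ^ 2 := by positivity
    have h6 : 1 + (A + 2) / (A - 2) * x ^ 2 = ((A - 2) + (A + 2) * x ^ 2) / (A - 2) := by
      field_simp
    rw [h6]
    field_simp
  simp_rw [this]
  rw [integral_const_mul, Measure.integral_comp_mul_left (fun x => (1 + x ^ 2)⁻¹) r,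
    integral_univ_inv_one_add_sq, abs_of_pos (by positivity), smul_eq_mul]
  have h7 : √((A - 2) * (A + 2)) = (A - 2) * r := by
    rw [hr, eq_comm, ← sqrt_sq h1.le, ← sqrt_mul (by positivity), sqrt_sq h1.le]
    congr 1
    field_simp
  rw [h7]
  field_simp

theorem ellipticK_eq_integral_Ioi {k : ℝ} (hk : 0 < k) (hk1 : k < 1) :
    ellipticK k = ∫ y in Ioi (0 : ℝ), 1 / √((1 + y ^ 2) * (1 + (1 - k ^ 2) * y ^ 2)) := by
  have himg : (fun y : ℝ => sin (arctan y)) '' Ioi 0 = Ioo 0 1 := by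
    ext t
    simp only [mem_image, mem_Ioi, mem_Ioo]
    constructor
    · rintro ⟨y, hy, rfl⟩
      rw [sin_arctan]
      have : 0 < √(1 + y ^ 2) := sqrt_pos.2 (by positivity)
      refine ⟨by positivity, ?_⟩
      rw [div_lt_one this]
      exact lt_sqrt_of_sq_lt (by linarith)
    · rintro ⟨h0, h1⟩
      have h2 : 0 < arcsin t := arcsin_pos.2 h0
      have h3 : arcsin t < π / 2 := arcsin_lt_pi_div_two.2 h1
      refine ⟨tan (arcsin t), tan_pos_of_pos_of_lt_pi_div_two h2 h3, ?_⟩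
      rw [arctan_tan (by linarith [pi_pos]) h3, sin_arcsin (by linarith) h1.le]
  have hk2 : k ^ 2 < 1 := by nlinarith
  rw [ellipticK, intervalIntegral.integral_of_le zero_le_one, integral_Ioc_eq_integral_Ioo,
    ← himg, integral_image_eq_integral_abs_deriv_smul measurableSet_Ioi
    (f' := fun x => cos (arctan x) * (1 / (1 + x ^ 2)))
    (fun x _ => ((hasDerivAt_arctan x).sin).hasDerivWithinAt)]
  · refine setIntegral_congr_fun measurableSet_Ioi fun y _ => ?_
    have h3 : 0 < 1 + y ^ 2 := by positivity
    have h4 : 0 < 1 + (1 - k ^ 2) * y ^ 2 := by nlinarith [sq_nonneg y]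
    have hc := cos_arctan_pos y
    have e1 : (1 - y ^ 2 / (1 + y ^ 2)) * (1 - k ^ 2 * (y ^ 2 / (1 + y ^ 2))) =
        ((1 + y ^ 2) * (1 + (1 - k ^ 2) * y ^ 2)) / ((1 + y ^ 2) ^ 3) := by
      field_simp; ring
    have e2 : ((1 + y ^ 2) : ℝ) ^ 3 = ((1 + y ^ 2) * √(1 + y ^ 2)) ^ 2 := by
      rw [mul_pow, sq_sqrt h3.le]; ring
    have h5 : 0 < √(1 + y ^ 2) := sqrt_pos.2 h3
    rw [abs_of_pos (by positivity), smul_eq_mul, sin_sq_arctan, e1, e2, sqrt_div (by positivity),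
      sqrt_sq (by positivity), cos_arctan]
    have h6 : 0 < √((1 + y ^ 2) * (1 + (1 - k ^ 2) * y ^ 2)) := sqrt_pos.2 (by positivity)
    field_simp
  · intro x _ y _ h
    exact arctan_injective (injOn_sin ⟨(neg_pi_div_two_lt_arctan x).le, (arctan_lt_pi_div_two x).le⟩
      ⟨(neg_pi_div_two_lt_arctan y).le, (arctan_lt_pi_div_two y).le⟩ h)

theorem integral_inv_sqrt_eq_ellipticK {c : ℝ} (hc : 1 < c) :
    ∫ y in Ioo (-(1 / 2) : ℝ) (1 / 2),
      1 / √((4 * c - 2 * cos (2 * π * y) - 2) * (4 * c - 2 * cos (2 * π * y) + 2)) =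
      ellipticK (1 / c) / (2 * π * c) := by
  have h1 : 0 < c - 1 := by linarith
  have h0 : 0 < c := by linarith
  rw [integral_period_eq_integral_arctan]
  have e1 : ∀ x : ℝ, 1 / (π * (1 + x ^ 2)) *
      (1 / √((4 * c - 2 * cos (2 * π * (arctan x / π)) - 2) *
        (4 * c - 2 * cos (2 * π * (arctan x / π)) + 2))) =
      1 / (4 * π) * (fun z : ℝ => 1 / √((c - 1 + c * z ^ 2) * (c + (c + 1) * z ^ 2))) |x| := by
    intro x
    rw [cos_two_pi_mul_arctan_div_pi]
    simp only [sq_abs]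
    have h3 : 0 < 1 + x ^ 2 := by positivity
    have h4 : (4 * c - 2 * ((1 - x ^ 2) / (1 + x ^ 2)) - 2) *
        (4 * c - 2 * ((1 - x ^ 2) / (1 + x ^ 2)) + 2) =
        ((c - 1 + c * x ^ 2) * (c + (c + 1) * x ^ 2)) * (4 / (1 + x ^ 2)) ^ 2 := by
      field_simp; ring
    have h5 : 0 < √((c - 1 + c * x ^ 2) * (c + (c + 1) * x ^ 2)) := sqrt_pos.2 (by positivity)
    rw [h4, sqrt_mul (by positivity), sqrt_sq (by positivity)]
    field_simp
  simp_rw [e1]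
  rw [integral_const_mul, integral_comp_abs
    (f := fun z : ℝ => 1 / √((c - 1 + c * z ^ 2) * (c + (c + 1) * z ^ 2)))]
  set r := √((c - 1) / c) with hr
  have hr0 : 0 < r := sqrt_pos.2 (by positivity)
  have hr2 : r ^ 2 = (c - 1) / c := sq_sqrt (by positivity)
  have e2 := integral_comp_mul_left_Ioi
    (fun z : ℝ => 1 / √((c - 1 + c * z ^ 2) * (c + (c + 1) * z ^ 2))) 0 hr0
  rw [mul_zero, smul_eq_mul] at e2
  rw [ellipticK_eq_integral_Ioi (by positivity) (by rw [div_lt_one h0]; exact hc)]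
  have e3 : ∀ y : ℝ, 1 / √((c - 1 + c * (r * y) ^ 2) * (c + (c + 1) * (r * y) ^ 2)) =
      1 / (r * c) * (1 / √((1 + y ^ 2) * (1 + (1 - (1 / c) ^ 2) * y ^ 2))) := by
    intro y
    have : (c - 1 + c * (r * y) ^ 2) * (c + (c + 1) * (r * y) ^ 2) =
        (r * c) ^ 2 * ((1 + y ^ 2) * (1 + (1 - (1 / c) ^ 2) * y ^ 2)) := by
      simp only [mul_pow, hr2]
      field_simp
      ring
    rw [this, sqrt_mul (by positivity), sqrt_sq (by positivity), one_div_mul_one_div]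
  simp_rw [e3] at e2
  rw [integral_const_mul] at e2
  generalize (∫ z in Ioi (0 : ℝ), 1 / √((c - 1 + c * z ^ 2) * (c + (c + 1) * z ^ 2))) = I at e2 ⊢
  generalize (∫ y in Ioi (0 : ℝ),
    1 / √((1 + y ^ 2) * (1 + (1 - (1 / c) ^ 2) * y ^ 2))) = J at e2 ⊢
  field_simp at e2 ⊢
  rw [e2]
  ring

theorem integral_period_eq_integral_zero_pi (h : ℝ → ℝ) :
    ∫ x in Ioo (-(1 / 2) : ℝ) (1 / 2), h (sin (π * x) ^ 2) =
      1 / π * ∫ x in (0 : ℝ)..π, h (sin (x / 2) ^ 2) := by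
  have e1 : ∀ x : ℝ, (Ioo (-(1 / 2) : ℝ) (1 / 2)).indicator (fun x => h (sin (π * x) ^ 2)) x =
      (Iio (1 / 2)).indicator (fun x => h (sin (π * x) ^ 2)) |x| := by
    intro x
    have hs : sin (π * |x|) ^ 2 = sin (π * x) ^ 2 := by
      rcases abs_choice x with hx | hx <;> rw [hx]
      rw [mul_neg, sin_neg, neg_sq]
    simp only [indicator, mem_Ioo, mem_Iio, hs, ← abs_lt]
  rw [← integral_indicator measurableSet_Ioo]
  simp_rw [e1]
  rw [integral_comp_abs (f := (Iio (1 / 2)).indicator (fun x => h (sin (π * x) ^ 2))),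
    setIntegral_indicator measurableSet_Iio, Ioi_inter_Iio,
    ← integral_Ioc_eq_integral_Ioo, ← intervalIntegral.integral_of_le (by norm_num)]
  have := intervalIntegral.integral_comp_mul_left (a := 0) (b := 1 / 2)
    (fun x => h (sin (x / 2) ^ 2)) (c := 2 * π) (by positivity)
  have e : ∀ x : ℝ, 2 * π * x / 2 = π * x := fun x => by ring
  simp only [e, mul_zero, show 2 * π * (1 / 2) = π by ring, smul_eq_mul] at this
  rw [this]
  field_simp

theorem ellipticK_nonneg (k : ℝ) : 0 ≤ ellipticK k :=
  intervalIntegral.integral_nonneg zero_le_one fun _ _ => by positivity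

theorem ellipticK_le {k θ : ℝ} (hk : 0 < k) (hk1 : k < 1) (hθ : 0 < θ) (hθ1 : θ ≤ 1) :
    ellipticK k ≤ 2 / θ * (1 - k) ^ (-(θ / 2)) := by
  have hk' : 0 < 1 - k := by linarith
  have hint : IntervalIntegrable (fun t : ℝ => (1 - k) ^ (-(θ / 2)) * (1 - t) ^ (θ / 2 - 1))
      volume 0 1 := by
    have := (intervalIntegral.intervalIntegrable_rpow' (a := 0) (b := 1)
      (r := θ / 2 - 1) (by linarith)).comp_sub_left 1
    simp only [sub_zero, sub_self] at this
    exact this.symm.const_mul _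
  have hval : ∫ t in (0 : ℝ)..1, (1 - k) ^ (-(θ / 2)) * (1 - t) ^ (θ / 2 - 1) =
      2 / θ * (1 - k) ^ (-(θ / 2)) := by
    rw [intervalIntegral.integral_const_mul,
      intervalIntegral.integral_comp_sub_left (fun t => t ^ (θ / 2 - 1)),
      integral_rpow (Or.inl (by linarith))]
    have : θ / 2 ≠ 0 := by positivity
    simp only [sub_self, sub_zero, sub_add_cancel, one_rpow, zero_rpow this]
    field_simp
  rw [← hval, ellipticK]
  simp_rw [intervalIntegral.integral_of_le zero_le_one, integral_Ioc_eq_integral_Ioo]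
  have hint' := ((intervalIntegrable_iff_integrableOn_Ioc_of_le zero_le_one).1 hint).mono_set
    Ioo_subset_Ioc_self
  refine integral_mono_of_nonneg (Filter.Eventually.of_forall fun t => by positivity) hint' ?_
  filter_upwards [ae_restrict_mem measurableSet_Ioo] with t ht
  obtain ⟨h0, h1⟩ := ht
  have ht' : 0 < 1 - t := by linarith
  have hkt : k * t < 1 := by nlinarith
  have hM : (1 - t) ^ (1 - θ) * (1 - k) ^ θ ≤ 1 - k * t := by
    have hM0 : 0 < 1 - k * t := by linarith
    calc (1 - t) ^ (1 - θ) * (1 - k) ^ θ ≤ (1 - k * t) ^ (1 - θ) * (1 - k * t) ^ θ := by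
          gcongr <;> nlinarith
      _ = 1 - k * t := by rw [← rpow_add hM0, sub_add_cancel, rpow_one]
  have hP : 0 < (1 - t) ^ (1 - θ / 2) * (1 - k) ^ (θ / 2) := by positivity
  have hsq : (1 - t) ^ (1 - θ / 2) * (1 - k) ^ (θ / 2) ≤
      √((1 - t ^ 2) * (1 - k ^ 2 * t ^ 2)) := by
    refine le_sqrt_of_sq_le ?_
    rw [mul_pow, ← rpow_natCast, ← rpow_natCast, ← rpow_mul ht'.le, ← rpow_mul hk'.le]
    have e1 : (1 - θ / 2) * ((2 : ℕ) : ℝ) = 1 + (1 - θ) := by push_cast; ring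
    have e2 : θ / 2 * ((2 : ℕ) : ℝ) = θ := by push_cast; ring
    rw [e1, e2, rpow_add ht', rpow_one, mul_assoc]
    have hkt0 : 0 < k * t := by positivity
    refine mul_le_mul (by nlinarith) (hM.trans ?_) (by positivity) (by nlinarith)
    rw [← mul_pow]
    nlinarith
  calc 1 / √((1 - t ^ 2) * (1 - k ^ 2 * t ^ 2))
      ≤ 1 / ((1 - t) ^ (1 - θ / 2) * (1 - k) ^ (θ / 2)) := one_div_le_one_div_of_le hP hsq
    _ = (1 - k) ^ (-(θ / 2)) * (1 - t) ^ (θ / 2 - 1) := by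
        rw [rpow_neg hk'.le, show θ / 2 - 1 = -(1 - θ / 2) by ring, rpow_neg ht'.le, one_div,
          mul_inv, mul_comm]

theorem ellipticK_inv_div_le {c θ : ℝ} (hc : 1 < c) (hθ : 0 < θ) (hθ1 : θ ≤ 1) :
    ellipticK (1 / c) / c ≤ 2 / θ * (c - 1) ^ (-θ) := by
  have h0 : 0 < c := by linarith
  have h1 : 0 < c - 1 := by linarith
  have h2 := ellipticK_le (k := 1 / c) (by positivity) (by rw [div_lt_one h0]; exact hc) hθ hθ1
  have h3 : 1 - 1 / c = (c - 1) / c := by field_simp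
  rw [h3, div_rpow h1.le h0.le] at h2
  calc ellipticK (1 / c) / c ≤ 2 / θ * ((c - 1) ^ (-(θ / 2)) / c ^ (-(θ / 2))) / c := by gcongr
    _ = 2 / θ * ((c - 1) ^ (-(θ / 2)) * c ^ (θ / 2 - 1)) := by
        rw [rpow_neg h0.le, rpow_sub_one h0.ne']
        field_simp
    _ ≤ 2 / θ * ((c - 1) ^ (-(θ / 2)) * (c - 1) ^ (-(θ / 2))) := by
        gcongr 2 / θ * (_ * ?_)
        calc c ^ (θ / 2 - 1) ≤ c ^ (-(θ / 2)) := rpow_le_rpow_of_exponent_le hc.le (by linarith)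
          _ ≤ (c - 1) ^ (-(θ / 2)) := rpow_le_rpow_of_nonpos h1 (by linarith) (by linarith)
    _ = 2 / θ * (c - 1) ^ (-θ) := by
        rw [← rpow_add h1]; congr 2; ring

theorem bddAbove_rpow_mul_integral_ellipticK {θ : ℝ} (hθ : 0 < θ) (hθ1 : θ ≤ 1) :
    BddAbove {y : ℝ | ∃ lam : ℝ, 0 < lam ∧
      y = lam ^ θ * ∫ x in (0 : ℝ)..π,
        ellipticK (1 / (lam / 4 + 1 + Real.sin (x / 2) ^ 2)) /
          (lam / 4 + 1 + Real.sin (x / 2) ^ 2)} := by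
  refine ⟨2 / θ * 4 ^ θ * π, ?_⟩
  rintro _ ⟨lam, hlam, rfl⟩
  have hb := intervalIntegral.norm_integral_le_of_norm_le_const (a := 0) (b := π)
    (f := fun x => ellipticK (1 / (lam / 4 + 1 + Real.sin (x / 2) ^ 2)) /
          (lam / 4 + 1 + Real.sin (x / 2) ^ 2)) (C := 2 / θ * (lam / 4) ^ (-θ)) fun x _ => by
    have hs := sq_nonneg (sin (x / 2))
    rw [norm_of_nonneg (div_nonneg (ellipticK_nonneg _) (by positivity))]
    refine (ellipticK_inv_div_le (by linarith) hθ hθ1).trans ?_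
    gcongr 2 / θ * ?_
    exact rpow_le_rpow_of_nonpos (by positivity) (by linarith) (by linarith)
  rw [sub_zero, abs_of_pos pi_pos] at hb
  calc _ ≤ lam ^ θ * (2 / θ * (lam / 4) ^ (-θ) * π) := by
        gcongr
        exact (le_abs_self _).trans hb
    _ = 2 / θ * 4 ^ θ * π := by
        rw [rpow_neg (by positivity), div_rpow hlam.le (by norm_num)]
        have := rpow_pos_of_pos hlam θ
        field_simp

theorem interpolation_of_energy_bound_of_pos {θ a b M v : ℝ} (hθ : 0 < θ) (hθ1 : θ < 1)
    (ha : 0 < a) (hb : 0 < b) (h : ∀ t : ℝ, 0 < t → t ^ θ * v ≤ M * (t * a + b)) :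
    v ≤ M * (1 / (θ ^ θ * (1 - θ) ^ (1 - θ))) * a ^ θ * b ^ (1 - θ) := by
  have h1 : 0 < 1 - θ := by linarith
  have ht := h (θ * b / ((1 - θ) * a)) (by positivity)
  have e : θ * b / ((1 - θ) * a) * a + b = b / (1 - θ) := by field_simp; ring
  rw [e, div_rpow (by positivity) (by positivity), mul_rpow hθ.le hb.le, mul_rpow h1.le ha.le] at ht
  rw [rpow_sub h1, rpow_sub hb, rpow_one, rpow_one]
  have p1 := rpow_pos_of_pos hθ θ
  have p2 := rpow_pos_of_pos h1 θ
  have p3 := rpow_pos_of_pos ha θ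
  have p4 := rpow_pos_of_pos hb θ
  have := (le_div_iff₀' (by positivity)).2 ht
  refine this.trans (le_of_eq ?_)
  field_simp

theorem interpolation_of_energy_bound {θ a b M v : ℝ} (hθ : 0 < θ) (hθ1 : θ < 1) (ha : 0 ≤ a)
    (hb : 0 ≤ b) (hM : 0 ≤ M) (h : ∀ t : ℝ, 0 < t → t ^ θ * v ≤ M * (t * a + b)) :
    v ≤ M * (1 / (θ ^ θ * (1 - θ) ^ (1 - θ))) * a ^ θ * b ^ (1 - θ) := by
  have h1 : 0 < 1 - θ := by linarith
  have hcont : Continuous fun ε : ℝ =>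
      M * (1 / (θ ^ θ * (1 - θ) ^ (1 - θ))) * (a + ε) ^ θ * (b + ε) ^ (1 - θ) :=
    (continuous_const.mul ((continuous_const.add continuous_id).rpow_const fun _ =>
      Or.inr hθ.le)).mul ((continuous_const.add continuous_id).rpow_const fun _ => Or.inr h1.le)
  have hlim := (hcont.tendsto 0).mono_left (nhdsWithin_le_nhds (s := Ioi 0))
  simp only [add_zero] at hlim
  refine ge_of_tendsto hlim ?_
  filter_upwards [self_mem_nhdsWithin] with ε hε
  have hε' : 0 < ε := hε
  refine interpolation_of_energy_bound_of_pos hθ hθ1 (by positivity) (by positivity) fun t ht =>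
    (h t ht).trans ?_
  gcongr <;> linarith

theorem integral_pi_fin_three (μ : Measure ℝ) [IsFiniteMeasure μ] {f : (Fin 3 → ℝ) → ℝ}
    (hf : Continuous f) {C : ℝ} (hC : ∀ x, ‖f x‖ ≤ C) :
    ∫ x, f x ∂(Measure.pi fun _ => μ) = ∫ a, ∫ b, ∫ c, f ![a, b, c] ∂μ ∂μ ∂μ := by
  have h1 := (measurePreserving_piFinSuccAbove (fun _ : Fin 3 => μ) 0).symm.integral_comp' f
  rw [← h1, integral_prod]
  · congr 1 with a
    have h2 := (measurePreserving_finTwoArrow μ).symm.integral_comp'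
      (fun y => f ((MeasurableEquiv.piFinSuccAbove (fun _ : Fin 3 => ℝ) 0).symm (a, y)))
    have hv : ∀ b c : ℝ, (MeasurableEquiv.piFinSuccAbove (fun _ : Fin 3 => ℝ) 0).symm
        (a, MeasurableEquiv.finTwoArrow.symm (b, c)) = ![a, b, c] := by
      intro b c
      ext i
      fin_cases i <;> rfl
    refine h2.symm.trans ?_
    rw [integral_prod]
    · simp_rw [hv]
    · refine Integrable.of_bound (Measurable.aestronglyMeasurable ?_) C
        (Filter.Eventually.of_forall fun x => hC _)
      have := hf.measurable
      fun_prop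
  · refine Integrable.of_bound (Measurable.aestronglyMeasurable ?_) C
      (Filter.Eventually.of_forall fun x => hC _)
    exact hf.measurable.comp (MeasurableEquiv.measurable _)

/-- The fundamental domain of the three-dimensional torus centred at the origin. -/
def torusBox : Set (Fin 3 → ℝ) := {x | ∀ i, x i ∈ Ioc (-(1 / 2) : ℝ) (-(1 / 2) + 1)}

theorem integrableOn_torusBox (f : C(UnitAddTorus (Fin 3), ℂ)) :
    IntegrableOn (fun x : Fin 3 → ℝ => f (fun i => (x i : UnitAddCircle))) torusBox := by
  have hc : Continuous fun x : Fin 3 → ℝ => f (fun i => (x i : UnitAddCircle)) :=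
    f.continuous.comp (continuous_pi fun i =>
      (AddCircle.continuous_mk' 1).comp (continuous_apply i))
  refine (hc.integrableOn_Icc (a := fun _ => -(1 / 2)) (b := fun _ => -(1 / 2) + 1)).mono_set ?_
  intro x hx
  exact ⟨fun i => (hx i).1.le, fun i => (hx i).2⟩

/-- The mean of a continuous function over the torus, as a linear functional. -/
noncomputable def torusMean : C(UnitAddTorus (Fin 3), ℂ) →ₗ[ℂ] ℂ where
  toFun f := ∫ x in torusBox, f (fun i => (x i : UnitAddCircle))
  map_add' f g := integral_add (integrableOn_torusBox f) (integrableOn_torusBox g)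
  map_smul' c _ := integral_const_mul c _

theorem mFourierCoeff_eq_torusMean (f : C(UnitAddTorus (Fin 3), ℂ)) (n : Fin 3 → ℤ) :
    mFourierCoeff f n = torusMean (mFourier (-n) * f) :=
  mFourierCoeff_eq_integral f n fun _ => -(1 / 2)

theorem summable_sq_norm_torusMean (f : C(UnitAddTorus (Fin 3), ℂ)) :
    Summable fun n : Fin 3 → ℤ => ‖torusMean (mFourier (-n) * f)‖ ^ 2 := by
  simp_rw [← mFourierCoeff_eq_torusMean, ← mFourierCoeff_toLp]
  exact (hasSum_sq_mFourierCoeff _).summable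

theorem torusMean_mFourier (n : Fin 3 → ℤ) :
    torusMean (mFourier (-n)) = if n = 0 then 1 else 0 := by
  have h := mFourierBasis_repr (mFourierLp 2 (0 : Fin 3 → ℤ)) n
  rw [mFourierCoeff_toLp, mFourierCoeff_eq_torusMean, mFourier_zero, mul_one] at h
  rw [← h, ← coe_mFourierBasis, HilbertBasis.repr_self, lp.single_apply]
  simp [Pi.single_apply]

theorem re_fourier_one_le (y : UnitAddCircle) : (fourier 1 y).re ≤ 1 := by
  refine (Complex.re_le_norm _).trans ?_
  rw [fourier_apply, Circle.norm_coe]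

theorem re_fourier_one_coe (y : ℝ) : (fourier 1 (y : UnitAddCircle)).re = cos (2 * π * y) := by
  rw [fourier_coe_apply, show 2 * (π : ℂ) * Complex.I * (1 : ℤ) * (y : ℂ) / (1 : ℝ) =
    ((2 * π * y : ℝ) : ℂ) * Complex.I by push_cast; ring, Complex.exp_ofReal_mul_I_re]

/-- The Fourier symbol of `lam - Δ`. -/
noncomputable def latticeSymbol (lam : ℝ) (x : UnitAddTorus (Fin 3)) : ℝ :=
  lam + ∑ i, (2 - 2 * (fourier 1 (x i)).re)

theorem le_latticeSymbol (lam : ℝ) (x : UnitAddTorus (Fin 3)) : lam ≤ latticeSymbol lam x := by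
  have : 0 ≤ ∑ i, (2 - 2 * (fourier 1 (x i)).re) :=
    Finset.sum_nonneg fun i _ => by linarith [re_fourier_one_le (x i)]
  rw [latticeSymbol]
  linarith

theorem continuous_latticeSymbol (lam : ℝ) : Continuous (latticeSymbol lam) := by
  unfold latticeSymbol
  refine continuous_const.add (continuous_finsetSum _ fun i _ => ?_)
  exact continuous_const.sub (continuous_const.mul
    (Complex.continuous_re.comp ((fourier 1).continuous.comp (continuous_apply i))))

/-- The reciprocal of the Fourier symbol of `lam - Δ`. -/
noncomputable def latticeResolvent {lam : ℝ} (hlam : 0 < lam) : C(UnitAddTorus (Fin 3), ℂ) where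
  toFun x := (((latticeSymbol lam x)⁻¹ : ℝ) : ℂ)
  continuous_toFun := Complex.continuous_ofReal.comp ((continuous_latticeSymbol lam).inv₀
    fun x => (hlam.trans_le (le_latticeSymbol lam x)).ne')

theorem latticeResolvent_equation {lam : ℝ} (hlam : 0 < lam) :
    (lam : ℂ) • latticeResolvent hlam + ∑ i : Fin 3, ((2 : ℂ) • latticeResolvent hlam -
      mFourier (-Pi.single i 1) * latticeResolvent hlam -
      mFourier (Pi.single i 1) * latticeResolvent hlam) = 1 := by
  ext x
  have h0 : (latticeSymbol lam x : ℂ) ≠ 0 :=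
    Complex.ofReal_ne_zero.2 (hlam.trans_le (le_latticeSymbol lam x)).ne'
  simp only [ContinuousMap.add_apply, ContinuousMap.smul_apply, ContinuousMap.sum_apply,
    ContinuousMap.sub_apply, ContinuousMap.mul_apply, ContinuousMap.one_apply, smul_eq_mul,
    mFourier_neg, mFourier_single]
  have hF : latticeResolvent hlam x = (latticeSymbol lam x : ℂ)⁻¹ := by
    simp [latticeResolvent]
  rw [hF]
  have hsym : (latticeSymbol lam x : ℂ) =
      lam + ∑ i, (2 - (starRingEnd ℂ) (fourier 1 (x i)) - fourier 1 (x i)) := by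
    rw [latticeSymbol]
    push_cast
    congr 1
    refine Finset.sum_congr rfl fun i _ => ?_
    have := Complex.add_conj (fourier 1 (x i))
    push_cast at this
    rw [← this]
    ring
  simp_rw [← sub_mul]
  rw [← Finset.sum_mul, ← add_mul, ← hsym, mul_inv_cancel₀ h0]

/-- The Green's function of `lam - Δ` on `ℤ³`. -/
noncomputable def latticeGreen {lam : ℝ} (hlam : 0 < lam) (n : Fin 3 → ℤ) : ℝ :=
  (torusMean (mFourier (-n) * latticeResolvent hlam)).re

theorem summable_sq_latticeGreen {lam : ℝ} (hlam : 0 < lam) :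
    Summable fun n => latticeGreen hlam n ^ 2 := by
  refine Summable.of_nonneg_of_le (fun n => sq_nonneg _) (fun n => ?_)
    (summable_sq_norm_torusMean (latticeResolvent hlam))
  rw [latticeGreen, ← sq_abs]
  gcongr
  exact Complex.abs_re_le_norm _

theorem latticeGreen_equation {lam : ℝ} (hlam : 0 < lam) (n : Fin 3 → ℤ) :
    lam * latticeGreen hlam n + ∑ i : Fin 3, (2 * latticeGreen hlam n -
      latticeGreen hlam (n + Pi.single i 1) - latticeGreen hlam (n - Pi.single i 1)) =
      if n = 0 then 1 else 0 := by
  have hmul : ∀ m k : Fin 3 → ℤ, mFourier m * (mFourier k * latticeResolvent hlam) =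
      mFourier (m + k) * latticeResolvent hlam := by
    intro m k
    ext x
    simp only [ContinuousMap.mul_apply, mFourier_add, mul_assoc]
  have h := congrArg (fun f => torusMean (mFourier (-n) * f)) (latticeResolvent_equation hlam)
  simp only [mul_add, Finset.mul_sum, mul_sub, mul_smul_comm, hmul, mul_one, map_add, map_sum,
    map_sub, map_smul, torusMean_mFourier, smul_eq_mul] at h
  have h' := congrArg Complex.re h
  have e1 : ∀ i : Fin 3, -n + -Pi.single i 1 = -(n + Pi.single i 1) := fun i => by abel
  have e2 : ∀ i : Fin 3, -n + Pi.single i 1 = -(n - Pi.single i 1) := fun i => by abel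
  simp only [e1, e2, Complex.add_re, Complex.re_sum, Complex.sub_re, Complex.re_ofReal_mul] at h'
  rw [apply_ite Complex.re, Complex.one_re, Complex.zero_re] at h'
  rw [← h']
  simp [latticeGreen]

theorem latticeGreen_zero_eq_integral {lam : ℝ} (hlam : 0 < lam) :
    latticeGreen hlam 0 = ∫ x in torusBox,
      1 / (lam + ∑ i : Fin 3, (2 - 2 * cos (2 * π * x i))) := by
  rw [latticeGreen, neg_zero, mFourier_zero, one_mul]
  have : torusMean (latticeResolvent hlam) = ∫ x in torusBox,
      ((1 / (lam + ∑ i : Fin 3, (2 - 2 * cos (2 * π * x i))) : ℝ) : ℂ) := by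
    change ∫ x in torusBox, (((latticeSymbol lam _)⁻¹ : ℝ) : ℂ) = _
    simp only [latticeSymbol, re_fourier_one_coe, one_div]
  rw [this, integral_complex_ofReal, Complex.ofReal_re]

theorem latticeGreen_zero {lam : ℝ} (hlam : 0 < lam) :
    latticeGreen hlam 0 = 1 / (2 * π ^ 2) * ∫ x in (0 : ℝ)..π,
      ellipticK (1 / (lam / 4 + 1 + Real.sin (x / 2) ^ 2)) /
        (lam / 4 + 1 + Real.sin (x / 2) ^ 2) := by
  have hbox : torusBox = univ.pi fun _ => Ioc (-(1 / 2) : ℝ) (-(1 / 2) + 1) := by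
    ext x
    simp [torusBox]
  have hlow : ∀ x : Fin 3 → ℝ, lam ≤ lam + ∑ i : Fin 3, (2 - 2 * cos (2 * π * x i)) := fun x => by
    have : 0 ≤ ∑ i : Fin 3, (2 - 2 * cos (2 * π * x i)) :=
      Finset.sum_nonneg fun i _ => by linarith [cos_le_one (2 * π * x i)]
    linarith
  have hcont : Continuous fun x : Fin 3 → ℝ =>
      1 / (lam + ∑ i : Fin 3, (2 - 2 * cos (2 * π * x i))) :=
    continuous_const.div (by fun_prop) fun x => (hlam.trans_le (hlow x)).ne'
  rw [latticeGreen_zero_eq_integral, hbox, volume_pi, Measure.restrict_pi_pi,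
    integral_pi_fin_three _ hcont (C := 1 / lam)]
  · have hI : Ioc (-(1 / 2) : ℝ) (-(1 / 2) + 1) = Ioc (-(1 / 2) : ℝ) (1 / 2) := by norm_num
    have key : ∀ a : ℝ, ∫ b in Ioo (-(1 / 2) : ℝ) (1 / 2), ∫ c in Ioo (-(1 / 2) : ℝ) (1 / 2),
        1 / (lam + ∑ i : Fin 3, (2 - 2 * cos (2 * π * ![a, b, c] i))) =
        (fun s => ellipticK (1 / (lam / 4 + 1 + s)) / (2 * π * (lam / 4 + 1 + s)))
          (sin (π * a) ^ 2) := by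
      intro a
      have ha : cos (2 * π * a) = 1 - 2 * sin (π * a) ^ 2 := by
        rw [mul_assoc, cos_two_mul, cos_sq']
        ring
      have hs := sq_nonneg (sin (π * a))
      simp only
      rw [← integral_inv_sqrt_eq_ellipticK (by linarith)]
      congr 1 with b
      have hb := cos_le_one (2 * π * b)
      rw [← integral_inv_sub_two_mul_cos (by linarith)]
      congr 1 with c
      rw [Fin.sum_univ_three]
      simp only [Matrix.cons_val, ha]
      congr 1
      ring
    simp_rw [hI, integral_Ioc_eq_integral_Ioo, key]
    rw [integral_period_eq_integral_zero_pi
      (fun s => ellipticK (1 / (lam / 4 + 1 + s)) / (2 * π * (lam / 4 + 1 + s)))]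
    have : ∀ x : ℝ, ellipticK (1 / (lam / 4 + 1 + sin (x / 2) ^ 2)) /
        (2 * π * (lam / 4 + 1 + sin (x / 2) ^ 2)) = 1 / (2 * π) *
        (ellipticK (1 / (lam / 4 + 1 + sin (x / 2) ^ 2)) / (lam / 4 + 1 + sin (x / 2) ^ 2)) := by
      intro x
      rw [← div_div, div_right_comm]
      ring
    simp_rw [this]
    rw [intervalIntegral.integral_const_mul]
    ring
  · intro x
    have h1 := hlow x
    rw [norm_of_nonneg (by positivity [hlam.trans_le h1])]
    exact one_div_le_one_div_of_le hlam h1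

/-- The inclusion of `ℤ × ℤ × ℤ` into functions on `Fin 3`. -/
def latticePoint : ℤ × ℤ × ℤ →+ (Fin 3 → ℤ) where
  toFun p := ![p.1, p.2.1, p.2.2]
  map_zero' := by
    ext i
    fin_cases i <;> rfl
  map_add' p q := by
    ext i
    fin_cases i <;> rfl

theorem latticePoint_injective : Function.Injective latticePoint := by
  intro p q h
  exact Prod.ext (congrFun h 0) (Prod.ext (congrFun h 1) (congrFun h 2))

theorem sq_apply_zero_le_energy {lam : ℝ} (hlam : 0 < lam) {u : ℤ × ℤ × ℤ → ℝ}
    (hu : Summable fun p => u p ^ 2) :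
    u (0, 0, 0) ^ 2 ≤ latticeGreen hlam 0 * (lam * (∑' p, u p ^ 2) + ∑' p : ℤ × ℤ × ℤ,
      ((u (p.1 + 1, p.2.1, p.2.2) - u p) ^ 2 + (u (p.1, p.2.1 + 1, p.2.2) - u p) ^ 2 +
        (u (p.1, p.2.1, p.2.2 + 1) - u p) ^ 2)) := by
  let e : Fin 3 → ℤ × ℤ × ℤ := ![(1, 0, 0), (0, 1, 0), (0, 0, 1)]
  have he : ∀ i, latticePoint (e i) = Pi.single i 1 := by
    intro i
    ext j
    fin_cases i <;> fin_cases j <;> rfl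
  have h := sq_apply_zero_le_green_mul_energy hlam (e := e) hu
    (w := fun p => latticeGreen hlam (latticePoint p))
    ((summable_sq_latticeGreen hlam).comp_injective latticePoint_injective) (fun p => by
      simp only [map_add, map_sub, he]
      rw [latticeGreen_equation]
      simp only [map_eq_zero_iff _ latticePoint_injective])
  rw [show ((0, 0, 0) : ℤ × ℤ × ℤ) = 0 from rfl]
  simpa [Fin.sum_univ_three, e, Prod.add_def] using h

end Integrals

/-- For `θ ∈ (0,1)`, the constant
`K₃(θ) = (1/(2π²)) (1/(θ^θ(1-θ)^{1-θ})) sup_{λ>0} λ^θ ∫₀^π K(1/(λ/4+1+sin²(x/2)))/(λ/4+1+sin²(x/2)) dx`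
is finite and `u(0,0,0)² ≤ K₃(θ) ‖u‖^{2θ} ‖∇u‖^{2(1-θ)}` for every `u ∈ l²(ℤ³)`. -/
theorem interpolation_3D (θ : ℝ) (hθ : θ ∈ Set.Ioo (0 : ℝ) 1) :
    BddAbove {y : ℝ | ∃ lam : ℝ, 0 < lam ∧
      y = lam ^ θ * ∫ x in (0 : ℝ)..π,
        ellipticK (1 / (lam / 4 + 1 + Real.sin (x / 2) ^ 2)) /
          (lam / 4 + 1 + Real.sin (x / 2) ^ 2)} ∧
    ∀ u : ℤ × ℤ × ℤ → ℝ, Summable (fun p => u p ^ 2) →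
      u (0, 0, 0) ^ 2 ≤
        ((1 / (2 * π ^ 2)) * (1 / (θ ^ θ * (1 - θ) ^ (1 - θ))) *
          sSup {y : ℝ | ∃ lam : ℝ, 0 < lam ∧
            y = lam ^ θ * ∫ x in (0 : ℝ)..π,
              ellipticK (1 / (lam / 4 + 1 + Real.sin (x / 2) ^ 2)) /
                (lam / 4 + 1 + Real.sin (x / 2) ^ 2)}) *
        (∑' p : ℤ × ℤ × ℤ, u p ^ 2) ^ θ *
        (∑' p : ℤ × ℤ × ℤ,
          ((u (p.1 + 1, p.2.1, p.2.2) - u p) ^ 2 +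
            (u (p.1, p.2.1 + 1, p.2.2) - u p) ^ 2 +
            (u (p.1, p.2.1, p.2.2 + 1) - u p) ^ 2)) ^ (1 - θ) := by
  refine ⟨bddAbove_rpow_mul_integral_ellipticK hθ.1 hθ.2.le, fun u hu => ?_⟩
  have hbdd := bddAbove_rpow_mul_integral_ellipticK hθ.1 hθ.2.le
  set S := sSup {y : ℝ | ∃ lam : ℝ, 0 < lam ∧
    y = lam ^ θ * ∫ x in (0 : ℝ)..π,
      ellipticK (1 / (lam / 4 + 1 + Real.sin (x / 2) ^ 2)) /
        (lam / 4 + 1 + Real.sin (x / 2) ^ 2)} with hS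
  have hle : ∀ lam : ℝ, ∀ h : 0 < lam, lam ^ θ * latticeGreen h 0 ≤ 1 / (2 * π ^ 2) * S := by
    intro lam hlam
    rw [latticeGreen_zero, mul_left_comm]
    gcongr
    exact le_csSup hbdd ⟨lam, hlam, rfl⟩
  have hS0 : 0 ≤ S := by
    refine Real.sSup_nonneg ?_
    rintro _ ⟨lam, hlam, rfl⟩
    refine mul_nonneg (by positivity) (intervalIntegral.integral_nonneg pi_pos.le fun x _ => ?_)
    exact div_nonneg (ellipticK_nonneg _) (by positivity)
  have h := interpolation_of_energy_bound hθ.1 hθ.2 (a := ∑' p, u p ^ 2)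
    (b := ∑' p : ℤ × ℤ × ℤ,
      ((u (p.1 + 1, p.2.1, p.2.2) - u p) ^ 2 + (u (p.1, p.2.1 + 1, p.2.2) - u p) ^ 2 +
        (u (p.1, p.2.1, p.2.2 + 1) - u p) ^ 2))
    (M := 1 / (2 * π ^ 2) * S) (v := u (0, 0, 0) ^ 2)
    (tsum_nonneg fun p => by positivity) (tsum_nonneg fun p => by positivity) (by positivity)
    fun t ht => by
      have ha : 0 ≤ ∑' p, u p ^ 2 := tsum_nonneg fun p => by positivity
      have hb : 0 ≤ ∑' p : ℤ × ℤ × ℤ,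
        ((u (p.1 + 1, p.2.1, p.2.2) - u p) ^ 2 + (u (p.1, p.2.1 + 1, p.2.2) - u p) ^ 2 +
          (u (p.1, p.2.1, p.2.2 + 1) - u p) ^ 2) := tsum_nonneg fun p => by positivity
      refine (mul_le_mul_of_nonneg_left (sq_apply_zero_le_energy ht hu)
        (rpow_nonneg ht.le θ)).trans ?_
      rw [← mul_assoc]
      exact mul_le_mul_of_nonneg_right (hle t ht) (add_nonneg (mul_nonneg ht.le ha) hb)
  refine h.trans (le_of_eq ?_)
  ring
end
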